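/- arXiv:2512.21977 — 2 statements merged into one kernel-verified Lean document; each statement's English description precedes it below -/
import Mathlib

section
/- Let K_m be the complete graph on m ≥ 2 vertices and let T_m be a uniformly random spanning tree of K_m. If u, v are two distinct vertices of K_m, then for every integer L with 1 ≤ L ≤ m − 1: P( d_{T_m}(u,v) ≥ L ) = ∏_{k=1}^{L−1} (m − k − 1)/m = (m−2)! / ( m^{L−1} (m−1−L)! ). -/
open scoped Classical in
/-- The finset of all spanning trees of the complete graph on `Fin m`
(every tree on the vertex set `Fin m` is a spanning tree of `K_m`). -/
noncomputable def treeFinset (m : ℕ) : Finset (SimpleGraph (Fin m)) :=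
  Finset.univ.filter fun T => T.IsTree

namespace USTProof

section Count
variable {V : Type*}

/-- Parent functions of forests with root set `S`. -/
def IsF (S : Finset V) (f : V → V) : Prop :=
  (∀ s ∈ S, f s = s) ∧ ∀ x, ∃ n, f^[n] x ∈ S

lemma iter_fix {f : V → V} {s : V} (h : f s = s) (n : ℕ) : f^[n] s = s :=
  Function.iterate_fixed h n

lemma iter_stay {f : V → V} {s x : V} (h : f s = s) {n k : ℕ} (hn : f^[n] x = s) (hk : n ≤ k) :
    f^[k] x = s := by
  obtain ⟨d, rfl⟩ := Nat.exists_eq_add_of_le' hk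
  rw [Function.iterate_add_apply, hn, iter_fix h]

lemma not_return {S : Finset V} {f : V → V} (hf : IsF S f) {x : V} (hx : x ∉ S) (n : ℕ) :
    f^[n] (f x) ≠ x := by
  intro h
  have h1 : f^[n + 1] x = x := by rw [Function.iterate_succ_apply]; exact h
  obtain ⟨N, hN⟩ := hf.2 x
  have h2 : f^[(n + 1) * N] x = x := by
    rw [Function.iterate_mul]; exact iter_fix h1 N
  have h3 := iter_stay (hf.1 _ hN) (rfl : f^[N] x = _) (show N ≤ (n + 1) * N by nlinarith)
  rw [h2] at h3
  rw [← h3] at hN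
  exact hx hN

variable [DecidableEq V]

lemma iter_update {f : V → V} {x y z : V} {n : ℕ} (h : ∀ i < n, f^[i] z ≠ x) :
    (Function.update f x y)^[n] z = f^[n] z := by
  induction n with
  | zero => rfl
  | succ n ih =>
    rw [Function.iterate_succ_apply', Function.iterate_succ_apply',
      ih (fun i hi => h i (by omega)), Function.update_of_ne (h n (by omega))]

lemma isF_down {S : Finset V} {f : V → V} (hf : IsF S f) {x : V} :
    IsF (insert x S) (Function.update f x x) := by
  constructor
  · intro s hs
    by_cases h : s = x
    · subst h; simp
    · rw [Function.update_of_ne h]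
      exact hf.1 s (by simpa [h] using hs)
  · intro z
    have hex : ∃ n, f^[n] z ∈ insert x S := by
      obtain ⟨n, hn⟩ := hf.2 z
      exact ⟨n, by simp [hn]⟩
    refine ⟨Nat.find hex, ?_⟩
    rw [iter_update]
    · exact Nat.find_spec hex
    · intro i hi h
      exact Nat.find_min hex hi (by simp [h])

lemma avoid {S : Finset V} {g : V → V} {x y v : V} (hx : x ∉ S) (hv : v ∈ S)
    (hg : IsF (insert x S) g) (h : ∃ n, g^[n] y = v) (i : ℕ) : g^[i] y ≠ x := by
  obtain ⟨n, hn⟩ := h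
  intro hi
  have h1 := iter_stay (hg.1 v (by simp [hv])) hn (le_max_left n i)
  have h2 := iter_stay (hg.1 x (by simp)) hi (le_max_right n i)
  exact hx (by rw [← h2, h1]; exact hv)

lemma isF_up {S : Finset V} {g : V → V} {x y v : V} (hx : x ∉ S) (hv : v ∈ S)
    (hg : IsF (insert x S) g) (h : ∃ n, g^[n] y = v) : IsF S (Function.update g x y) := by
  have hav := avoid hx hv hg h
  constructor
  · intro s hs
    rw [Function.update_of_ne (by rintro rfl; exact hx hs)]
    exact hg.1 s (by simp [hs])
  · intro z
    have hex := hg.2 z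
    have key : (Function.update g x y)^[Nat.find hex] z = g^[Nat.find hex] z := by
      apply iter_update
      intro i hi h
      exact Nat.find_min hex hi (by simp [h])
    rcases Finset.mem_insert.1 (Nat.find_spec hex) with h1 | h1
    · obtain ⟨n, hn⟩ := h
      refine ⟨n + 1 + Nat.find hex, ?_⟩
      rw [Function.iterate_add_apply, key, h1, Function.iterate_succ_apply, Function.update_self,
        iter_update (fun i _ => hav i), hn]
      exact hv
    · exact ⟨Nat.find hex, by rw [key]; exact h1⟩

variable [Fintype V]

open scoped Classical in
/-- forests with root set `S`. -/
noncomputable def R (S : Finset V) : Finset (V → V) := Finset.univ.filter (IsF S)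

open scoped Classical in
/-- forests with root set `S` in which the root of `x` is `v`, with distance more than `l`. -/
noncomputable def Q (S : Finset V) (v x : V) (l : ℕ) : Finset (V → V) :=
  Finset.univ.filter fun f => IsF S f ∧ (∃ n, f^[n] x = v) ∧ (f^[l] x ∉ S)

open scoped Classical in
/-- forests with root set `S` in which the root of `x` is `v`. -/
noncomputable def C (S : Finset V) (v x : V) : Finset (V → V) :=
  Finset.univ.filter fun f => IsF S f ∧ (∃ n, f^[n] x = v)

lemma iter_f {S : Finset V} {f : V → V} (hf : IsF S f) {x : V} (hx : x ∉ S) (n : ℕ) :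
    (Function.update f x x)^[n] (f x) = f^[n] (f x) :=
  iter_update (fun i _ => not_return hf hx i)

lemma root_step {f : V → V} {x v : V} (hxv : x ≠ v) :
    (∃ n, f^[n] x = v) ↔ ∃ n, f^[n] (f x) = v := by
  constructor
  · rintro ⟨n, hn⟩
    cases n with
    | zero => exact absurd hn hxv
    | succ n => exact ⟨n, hn⟩
  · rintro ⟨n, hn⟩
    exact ⟨n + 1, hn⟩

lemma C_rec {S : Finset V} {v x : V} (hx : x ∉ S) (hv : v ∈ S) :
    (C S v x).card = ∑ y : V, (C (insert x S) v y).card := by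
  classical
  have hxv : x ≠ v := by rintro rfl; exact hx hv
  rw [Finset.card_eq_sum_card_fiberwise (f := fun f => f x) (t := Finset.univ) (by simp)]
  refine Finset.sum_congr rfl fun y _ => ?_
  refine Finset.card_nbij' (fun f => Function.update f x x) (fun g => Function.update g x y)
    ?_ ?_ ?_ ?_
  · intro f hf
    simp only [C, Finset.coe_filter, Finset.mem_filter, Finset.mem_univ, true_and,
      Set.mem_ofPred_eq] at hf ⊢
    obtain ⟨⟨hf, hr⟩, rfl⟩ := hf
    refine ⟨isF_down hf, ?_⟩
    simp_rw [iter_f hf hx]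
    exact (root_step hxv).1 hr
  · intro g hg
    simp only [C, Finset.coe_filter, Finset.mem_filter, Finset.mem_univ, true_and,
      Set.mem_ofPred_eq] at hg ⊢
    obtain ⟨hg, hr⟩ := hg
    refine ⟨⟨isF_up hx hv hg hr, ?_⟩, by simp⟩
    rw [root_step hxv]
    simp_rw [Function.update_self, iter_update (fun i _ => avoid hx hv hg hr i)]
    exact hr
  · intro f hf
    simp only [C, Finset.coe_filter, Finset.mem_filter, Finset.mem_univ, true_and,
      Set.mem_ofPred_eq] at hf
    simp [← hf.2]
  · intro g hg
    simp only [C, Finset.coe_filter, Finset.mem_univ, true_and,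
      Set.mem_ofPred_eq] at hg
    have := hg.1.1 x (by simp)
    simp only [Function.update_idem]
    exact Function.update_eq_self_iff.2 this.symm

lemma Q_rec {S : Finset V} {v x : V} (hx : x ∉ S) (hv : v ∈ S) (l : ℕ) :
    (Q S v x (l + 1)).card = ∑ y : V, (Q (insert x S) v y l).card := by
  classical
  have hxv : x ≠ v := by rintro rfl; exact hx hv
  rw [Finset.card_eq_sum_card_fiberwise (f := fun f => f x) (t := Finset.univ) (by simp)]
  refine Finset.sum_congr rfl fun y _ => ?_
  refine Finset.card_nbij' (fun f => Function.update f x x) (fun g => Function.update g x y)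
    ?_ ?_ ?_ ?_
  · intro f hf
    simp only [Q, Finset.coe_filter, Finset.mem_filter, Finset.mem_univ, true_and,
      Set.mem_ofPred_eq] at hf ⊢
    obtain ⟨⟨hf, hr, hl⟩, rfl⟩ := hf
    refine ⟨isF_down hf, ?_⟩
    simp_rw [iter_f hf hx]
    refine ⟨(root_step hxv).1 hr, ?_⟩
    rw [Finset.mem_insert, not_or]
    exact ⟨not_return hf hx l, hl⟩
  · intro g hg
    simp only [Q, Finset.coe_filter, Finset.mem_filter, Finset.mem_univ, true_and,
      Set.mem_ofPred_eq] at hg ⊢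
    obtain ⟨hg, hr, hl⟩ := hg
    refine ⟨⟨isF_up hx hv hg hr, ?_⟩, by simp⟩
    rw [root_step hxv]
    simp_rw [Function.iterate_succ_apply, Function.update_self,
      iter_update (fun i _ => avoid hx hv hg hr i)]
    exact ⟨hr, fun h => hl (by simp [h])⟩
  · intro f hf
    simp only [Q, Finset.coe_filter, Finset.mem_filter, Finset.mem_univ, true_and,
      Set.mem_ofPred_eq] at hf
    simp [← hf.2]
  · intro g hg
    simp only [Q, Finset.coe_filter, Finset.mem_univ, true_and,
      Set.mem_ofPred_eq] at hg
    have := hg.1.1 x (by simp)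
    simp only [Function.update_idem]
    exact Function.update_eq_self_iff.2 this.symm

lemma R_eq_sum (S : Finset V) (x : V) : (R S).card = ∑ s ∈ S, (C S s x).card := by
  classical
  rw [← Finset.card_biUnion]
  · congr 1
    ext f
    simp only [R, C, Finset.mem_filter, Finset.mem_univ, true_and, Finset.mem_biUnion]
    constructor
    · intro h
      obtain ⟨n, hn⟩ := h.2 x
      exact ⟨_, hn, h, n, rfl⟩
    · rintro ⟨s, -, h, -⟩
      exact h
  · intro s hs t ht hst
    refine Finset.disjoint_left.2 fun f hf hg => hst ?_
    simp only [C, Finset.mem_filter, Finset.mem_univ, true_and] at hf hg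
    obtain ⟨h, n, hn⟩ := hf
    obtain ⟨-, k, hk⟩ := hg
    rw [← iter_stay (h.1 s hs) hn (le_max_left n k), iter_stay (h.1 t ht) hk (le_max_right n k)]

lemma C_self {S : Finset V} {v : V} : C S v v = R S := by
  classical
  ext f
  simp only [R, C, Finset.mem_filter, Finset.mem_univ, true_and, and_iff_left_iff_imp]
  exact fun _ => ⟨0, rfl⟩

lemma C_other {S : Finset V} {v y : V} (hy : y ∈ S) (h : y ≠ v) : C S v y = ∅ := by
  classical
  ext f
  simp only [C, Finset.mem_filter, Finset.mem_univ, true_and, Finset.notMem_empty, iff_false]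
  rintro ⟨hf, n, hn⟩
  exact h (by rw [← hn, iter_fix (hf.1 y hy)])

lemma Q_other {S : Finset V} {v y : V} (hy : y ∈ S) (l : ℕ) : Q S v y l = ∅ := by
  classical
  ext f
  simp only [Q, Finset.mem_filter, Finset.mem_univ, true_and, Finset.notMem_empty, iff_false]
  rintro ⟨hf, -, hn⟩
  exact hn (by rw [iter_fix (hf.1 y hy)]; exact hy)

lemma R_univ : (R (Finset.univ : Finset V)).card = 1 := by
  classical
  rw [Finset.card_eq_one]
  refine ⟨id, ?_⟩
  ext f
  simp only [R, IsF, Finset.mem_filter, Finset.mem_univ, true_and, Finset.mem_singleton]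
  constructor
  · rintro ⟨h, -⟩
    funext x; exact h x trivial
  · rintro rfl
    exact ⟨fun _ _ => rfl, fun _ => ⟨0, trivial⟩⟩

lemma C_card (d : ℕ) : ∀ (S : Finset V) (v x : V), x ∉ S → v ∈ S →
    S.card + d + 1 = Fintype.card V → (C S v x).card = Fintype.card V ^ d := by
  classical
  induction d with
  | zero =>
    intro S v x hx hv hc
    have hu : insert x S = Finset.univ := by
      rw [← Finset.card_eq_iff_eq_univ, Finset.card_insert_of_notMem hx]; omega
    rw [C_rec hx hv, hu, Finset.sum_eq_single v, C_self, R_univ, pow_zero]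
    · intro y _ hy
      rw [C_other (Finset.mem_univ y) hy, Finset.card_empty]
    · simp
  | succ d ih =>
    intro S v x hx hv hc
    have hci := Finset.card_insert_of_notMem hx
    have hv' : v ∈ insert x S := by simp [hv]
    rw [C_rec hx hv, ← Finset.sum_add_sum_compl (insert x S), Finset.sum_eq_single_of_mem v hv',
      C_self]
    · have hcc : (insert x S)ᶜ.card = d + 1 := by rw [Finset.card_compl]; omega
      have h2 : ∑ y ∈ (insert x S)ᶜ, (C (insert x S) v y).card
          = (d + 1) * Fintype.card V ^ d := by
        rw [Finset.sum_congr rfl (fun y hy => ih (insert x S) v y (Finset.mem_compl.1 hy) hv'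
          (by omega)), Finset.sum_const, hcc, smul_eq_mul]
      obtain ⟨y, hy⟩ : ((insert x S)ᶜ).Nonempty := by rw [← Finset.card_pos]; omega
      rw [h2, R_eq_sum _ y, Finset.sum_congr rfl
        (fun s hs => ih (insert x S) s y (Finset.mem_compl.1 hy) hs (by omega)),
        Finset.sum_const, smul_eq_mul, ← add_mul, pow_succ, mul_comm]
      congr 1
      omega
    · intro y hy hyv
      rw [C_other hy hyv, Finset.card_empty]

lemma Q_zero {S : Finset V} {v x : V} (hx : x ∉ S) : Q S v x 0 = C S v x := by
  classical
  ext f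
  simp [Q, C, hx]

lemma Q_card (l : ℕ) : ∀ (d : ℕ) (S : Finset V) (v x : V), x ∉ S → v ∈ S →
    S.card + (d + l) + 1 = Fintype.card V →
    (Q S v x l).card = (d + l).descFactorial l * Fintype.card V ^ d := by
  classical
  induction l with
  | zero =>
    intro d S v x hx hv hc
    rw [Q_zero hx, C_card d S v x hx hv (by omega)]
    simp
  | succ l ih =>
    intro d S v x hx hv hc
    have hci := Finset.card_insert_of_notMem hx
    have hv' : v ∈ insert x S := by simp [hv]
    have hcc : (insert x S)ᶜ.card = d + l + 1 := by rw [Finset.card_compl]; omega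
    rw [Q_rec hx hv, ← Finset.sum_add_sum_compl (insert x S), Finset.sum_eq_zero, zero_add,
      Finset.sum_congr rfl (fun y hy => ih d (insert x S) v y (Finset.mem_compl.1 hy) hv'
        (by omega)), Finset.sum_const, hcc, smul_eq_mul, ← mul_assoc, ← add_assoc,
      Nat.succ_descFactorial_succ]
    intro y hy
    rw [Q_other hy, Finset.card_empty]

end Count

section Tree
variable {V : Type*}

/-- The graph of a parent function. -/
def tr (f : V → V) : SimpleGraph V := SimpleGraph.fromRel fun x y => f x = y

lemma tr_adj {f : V → V} {x y : V} : (tr f).Adj x y ↔ x ≠ y ∧ (f x = y ∨ f y = x) := by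
  simp [tr]

lemma tr_reach (f : V → V) (x : V) : (tr f).Reachable x (f x) := by
  by_cases h : x = f x
  · rw [← h]
  · exact (tr_adj.2 ⟨h, Or.inl rfl⟩).reachable

variable [DecidableEq V]

/-- Parent functions of trees rooted at `v`. -/
def PF (v : V) (f : V → V) : Prop := f v = v ∧ ∀ x, ∃ n, f^[n] x = v

lemma PF_iff {v : V} {f : V → V} : IsF {v} f ↔ PF v f := by simp [IsF, PF]

/-- depth -/
def ht {v : V} {f : V → V} (hf : PF v f) (x : V) : ℕ := Nat.find (hf.2 x)

lemma ht_le {v : V} {f : V → V} (hf : PF v f) (x : V) (n : ℕ) : ht hf x ≤ n ↔ f^[n] x = v := by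
  constructor
  · intro h
    exact iter_stay hf.1 (Nat.find_spec (hf.2 x)) h
  · exact fun h => Nat.find_min' _ h

lemma ht_root {v : V} {f : V → V} (hf : PF v f) : ht hf v = 0 :=
  Nat.le_zero.1 ((ht_le hf v 0).2 rfl)

lemma ht_step {v : V} {f : V → V} (hf : PF v f) {x : V} (hx : x ≠ v) :
    ht hf x = ht hf (f x) + 1 := by
  apply le_antisymm
  · rw [ht_le, Function.iterate_succ_apply, ← ht_le hf]
  · have h0 : ht hf x ≠ 0 := by
      intro h
      exact hx ((ht_le hf x 0).1 h.le)
    obtain ⟨k, hk⟩ := Nat.exists_eq_succ_of_ne_zero h0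
    have := (ht_le hf x _).1 hk.le
    rw [Function.iterate_succ_apply, ← ht_le hf] at this
    omega

lemma ht_lip {v : V} {f : V → V} (hf : PF v f) {x y : V} (h : (tr f).Adj x y) :
    ht hf x ≤ ht hf y + 1 := by
  obtain ⟨hne, rfl | rfl⟩ := tr_adj.1 h
  · have hx : x ≠ v := by rintro rfl; exact hne hf.1.symm
    exact (ht_step hf hx).le
  · have hx : y ≠ v := by rintro rfl; exact hne hf.1
    have := ht_step hf hx
    omega

lemma ht_walk {v : V} {f : V → V} (hf : PF v f) {x y : V} (p : (tr f).Walk x y) :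
    ht hf x ≤ ht hf y + p.length := by
  induction p with
  | nil => simp
  | cons h p ih =>
    have := ht_lip hf h
    rw [SimpleGraph.Walk.length_cons]; omega

lemma tr_walk {v : V} {f : V → V} (hf : PF v f) (n : ℕ) : ∀ x, ht hf x = n →
    ∃ p : (tr f).Walk x v, p.length = n := by
  induction n with
  | zero =>
    intro x hx
    have : x = v := (ht_le hf x 0).1 hx.le
    subst this
    exact ⟨.nil, rfl⟩
  | succ n ih =>
    intro x hx
    have hxv : x ≠ v := by rintro rfl; rw [ht_root] at hx; omega
    have hs := ht_step hf hxv
    obtain ⟨p, hp⟩ := ih (f x) (by omega)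
    have hne : x ≠ f x := by intro h; rw [← h] at hs; omega
    exact ⟨.cons (tr_adj.2 ⟨hne, Or.inl rfl⟩) p, by simp [hp]⟩

lemma tr_conn {v : V} {f : V → V} (hf : PF v f) : (tr f).Connected := by
  have h : ∀ x, (tr f).Reachable x v := fun x => by
    obtain ⟨p, -⟩ := tr_walk hf _ x rfl
    exact ⟨p⟩
  haveI : Nonempty V := ⟨v⟩
  exact ⟨fun x y => (h x).trans (h y).symm⟩

lemma tr_dist {v : V} {f : V → V} (hf : PF v f) (x : V) : (tr f).dist x v = ht hf x := by
  obtain ⟨p, hp⟩ := tr_walk hf _ x rfl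
  apply le_antisymm
  · rw [← hp]; exact SimpleGraph.dist_le p
  · obtain ⟨q, hq⟩ := (tr_conn hf).exists_walk_length_eq_dist x v
    have := ht_walk hf q
    rw [ht_root] at this
    omega

lemma tr_inj {v : V} {f g : V → V} (hf : PF v f) (hg : PF v g) (h : tr f = tr g) : f = g := by
  have hh : ∀ x, ht hf x = ht hg x := fun x => by rw [← tr_dist hf, ← tr_dist hg, h]
  funext x
  by_cases hx : x = v
  · rw [hx, hf.1, hg.1]
  · have h1 := ht_step hf hx
    have hne : x ≠ f x := by intro h; rw [← h] at h1; omega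
    have ha : (tr g).Adj x (f x) := h ▸ tr_adj.2 ⟨hne, Or.inl rfl⟩
    obtain ⟨-, h2 | h2⟩ := tr_adj.1 ha
    · exact h2.symm
    · have hfx : f x ≠ v := by
        intro h3; rw [h3, hg.1] at h2; exact hx h2.symm
      have h3 := ht_step hg hfx
      rw [h2, ← hh, ← hh] at h3
      omega

lemma tr_isTree [Fintype V] {v : V} {f : V → V} (hf : PF v f) : (tr f).IsTree := by
  classical
  rw [SimpleGraph.isTree_iff_connected_and_card]
  refine ⟨tr_conn hf, ?_⟩
  have h1 := (tr_conn hf).card_vert_le_card_edgeSet_add_one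
  refine le_antisymm ?_ h1
  have h2 : (tr f).edgeSet ⊆ (fun x => s(x, f x)) '' ({v}ᶜ : Set V) := by
    intro e
    induction e with | _ x y
    rw [SimpleGraph.mem_edgeSet, tr_adj]
    rintro ⟨hne, rfl | rfl⟩
    · exact ⟨x, by rintro rfl; exact hne hf.1.symm, rfl⟩
    · exact ⟨y, by rintro rfl; exact hne hf.1, Sym2.eq_swap⟩
  have h3 := Set.ncard_le_ncard h2 (Set.toFinite _)
  have h4 := Set.ncard_image_le (f := (fun x => s(x, f x))) (Set.toFinite ({v}ᶜ : Set V))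
  have h5 := Set.ncard_add_ncard_compl ({v} : Set V)
  rw [Set.ncard_singleton] at h5
  rw [Nat.card_coe_set_eq]
  omega

lemma tr_surj [Fintype V] (v : V) {T : SimpleGraph V} (hT : T.IsTree) :
    ∃ f, PF v f ∧ tr f = T := by
  classical
  have hc := hT.1
  have hex : ∀ x, ∃ y, (x = v → y = v) ∧ (x ≠ v → T.Adj x y ∧ T.dist x v = T.dist y v + 1) := by
    intro x
    by_cases hx : x = v
    · exact ⟨v, by simp [hx]⟩
    · obtain ⟨p, hp⟩ := hc.exists_walk_length_eq_dist x v
      cases p with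
      | nil => exact absurd rfl hx
      | cons h p =>
        rename_i y
        refine ⟨y, by simp [hx], fun _ => ⟨h, ?_⟩⟩
        rw [SimpleGraph.Walk.length_cons] at hp
        have h1 := SimpleGraph.dist_le p
        obtain ⟨q, hq⟩ := hc.exists_walk_length_eq_dist y v
        have h2 := SimpleGraph.dist_le (SimpleGraph.Walk.cons h q)
        rw [SimpleGraph.Walk.length_cons] at h2
        omega
  choose f hf1 hf2 using hex
  have hd : ∀ n x, T.dist x v = n → f^[n] x = v := by
    intro n
    induction n with
    | zero => intro x hx; exact (hc.dist_eq_zero_iff).1 hx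
    | succ n ih =>
      intro x hx
      have hxv : x ≠ v := by rintro rfl; simp at hx
      rw [Function.iterate_succ_apply]
      apply ih
      have := (hf2 x hxv).2
      omega
  have hf : PF v f := ⟨hf1 v rfl, fun x => ⟨_, hd _ x rfl⟩⟩
  refine ⟨f, hf, ?_⟩
  have hle : tr f ≤ T := by
    intro x y h
    obtain ⟨hne, rfl | rfl⟩ := tr_adj.1 h
    · exact (hf2 x (by rintro rfl; exact hne hf.1.symm)).1
    · exact (hf2 y (by rintro rfl; exact hne hf.1)).1.symm
  have c1 := (SimpleGraph.isTree_iff_connected_and_card.1 (tr_isTree hf)).2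
  have c2 := (SimpleGraph.isTree_iff_connected_and_card.1 hT).2
  rw [Nat.card_coe_set_eq] at c1 c2
  rw [← SimpleGraph.edgeSet_inj]
  exact Set.eq_of_subset_of_ncard_le (SimpleGraph.edgeSet_mono hle) (by omega) (Set.toFinite _)

end Tree

open scoped Classical in
lemma tree_card (m : ℕ) (u v : Fin m) (huv : u ≠ v) (l : ℕ) (hl : l + 2 ≤ m) :
    ((treeFinset m).filter fun T => l + 1 ≤ T.dist u v).card =
      (m - 2).descFactorial l * m ^ (m - 2 - l) := by
  have h := Q_card l (m - 2 - l) {v} v u (by simpa using huv) (by simp)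
    (by rw [Finset.card_singleton, Fintype.card_fin]; omega)
  rw [Fintype.card_fin, show m - 2 - l + l = m - 2 by omega] at h
  rw [← h]
  symm
  refine Finset.card_bij (fun f _ => tr f) ?_ ?_ ?_
  · intro f hf
    simp only [Q, treeFinset, Finset.mem_filter, Finset.mem_univ, true_and, PF_iff,
      Finset.mem_singleton] at hf ⊢
    obtain ⟨hf, -, hl⟩ := hf
    refine ⟨tr_isTree hf, ?_⟩
    rw [tr_dist hf, Nat.succ_le_iff, ← not_le, ht_le]
    exact hl
  · intro f hf g hg
    simp only [Q, Finset.mem_filter, Finset.mem_univ, true_and, PF_iff] at hf hg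
    exact tr_inj hf.1 hg.1
  · intro T hT
    simp only [treeFinset, Finset.mem_filter, Finset.mem_univ, true_and] at hT
    obtain ⟨f, hf, rfl⟩ := tr_surj v hT.1
    refine ⟨f, ?_, rfl⟩
    simp only [Q, Finset.mem_filter, Finset.mem_univ, true_and, PF_iff, Finset.mem_singleton]
    refine ⟨hf, hf.2 u, ?_⟩
    rw [← ht_le hf, not_le, ← tr_dist hf]
    exact hT.2

open scoped Classical in
lemma tree_card_total (m : ℕ) (u v : Fin m) (huv : u ≠ v) (hm : 2 ≤ m) :
    (treeFinset m).card = m ^ (m - 2) := by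
  have h := tree_card m u v huv 0 (by omega)
  rw [Finset.filter_true_of_mem] at h
  · simpa using h
  · intro T hT
    simp only [treeFinset, Finset.mem_filter, Finset.mem_univ, true_and] at hT
    exact (hT.1.pos_dist_of_ne huv)

lemma prod_eq (m : ℕ) (l : ℕ) (hl : l + 2 ≤ m) :
    ∏ k ∈ Finset.Icc 1 l, ((m : ℝ) - k - 1) / m = ((m - 2).descFactorial l : ℝ) / (m : ℝ) ^ l := by
  induction l with
  | zero => simp
  | succ l ih =>
    rw [Finset.prod_Icc_succ_top (by omega), ih (by omega), Nat.descFactorial_succ, pow_succ,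
      div_mul_div_comm]
    have : ((m - 2 - l : ℕ) : ℝ) = (m : ℝ) - (l + 1 : ℕ) - 1 := by
      rw [Nat.cast_sub (by omega), Nat.cast_sub (by omega)]; push_cast; ring
    rw [Nat.cast_mul, this, mul_comm ((m : ℝ) - _ - _)]

end USTProof

open scoped Classical in
/-- Let `T_m` be a uniformly random spanning tree of the complete graph
`K_m`, `m ≥ 2`. For distinct vertices `u, v` and `1 ≤ L ≤ m − 1`:
`P( d_{T_m}(u,v) ≥ L ) = ∏_{k=1}^{L−1} (m − k − 1)/m = (m−2)! / ( m^{L−1} (m−1−L)! )`. -/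
theorem ust_distance_formula (m : ℕ) (hm : 2 ≤ m) (u v : Fin m) (huv : u ≠ v)
    (L : ℕ) (hL1 : 1 ≤ L) (hLm : L ≤ m - 1) :
    ((((treeFinset m).filter fun T => L ≤ T.dist u v).card : ℝ) /
        ((treeFinset m).card : ℝ) =
      ∏ k ∈ Finset.Icc 1 (L - 1), ((m : ℝ) - k - 1) / m) ∧
    ((((treeFinset m).filter fun T => L ≤ T.dist u v).card : ℝ) /
        ((treeFinset m).card : ℝ) =
      (Nat.factorial (m - 2) : ℝ) / ((m : ℝ) ^ (L - 1) * (Nat.factorial (m - 1 - L)))) := by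
  obtain ⟨l, rfl⟩ := Nat.exists_eq_add_of_le' hL1
  have hl : l + 2 ≤ m := by omega
  have hm0 : (m : ℝ) ≠ 0 := by
    have : m ≠ 0 := by omega
    exact_mod_cast this
  have key : ((((treeFinset m).filter fun T => l + 1 ≤ T.dist u v).card : ℝ) /
        ((treeFinset m).card : ℝ)) = ((m - 2).descFactorial l : ℝ) / (m : ℝ) ^ l := by
    rw [USTProof.tree_card m u v huv l hl, USTProof.tree_card_total m u v huv hm]
    have : (m : ℝ) ^ (m - 2) = (m : ℝ) ^ (m - 2 - l) * (m : ℝ) ^ l := by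
      rw [← pow_add]; congr 1; omega
    push_cast
    rw [this]
    field_simp
  rw [key, Nat.add_sub_cancel]
  refine ⟨(USTProof.prod_eq m l hl).symm, ?_⟩
  have h := Nat.factorial_mul_descFactorial (show l ≤ m - 2 by omega)
  rw [show m - 1 - (l + 1) = m - 2 - l by omega, ← h]
  have : ((m - 2 - l).factorial : ℝ) ≠ 0 := by exact_mod_cast Nat.factorial_ne_zero _
  push_cast
  field_simp
end

section
/- There exists a constant C > 0 such that for every m ≥ 2, if T_m is a uniformly random spanning tree of the complete graph K_m and u, v are two vertices chosen independently and uniformly at random from the vertex set of K_m (independently of T_m), then E[ d_{T_m}(u,v) ] ≥ C √m. -/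
set_option linter.unusedSectionVars false
set_option linter.unusedSimpArgs false

namespace UST

open Finset

variable {V : Type} [Fintype V] [DecidableEq V]

/-- `p` is the parent function of a rooted forest (roots are the fixed points). -/
def IsF (p : V → V) : Prop := ∃ h : V → ℕ, ∀ v, p v ≠ v → h (p v) < h v

/-- The roots. -/
def Fx (p : V → V) : Finset V := univ.filter fun v => p v = v

/-- `q` extends the forest `p`. -/
def Ext (p q : V → V) : Prop := ∀ v, p v ≠ v → q v = p v

open scoped Classical in
/-- Rooted trees extending `p`. -/
noncomputable def Q (p : V → V) : Finset (V → V) :=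
  univ.filter fun q => IsF q ∧ (Fx q).card = 1 ∧ Ext p q

theorem exists_root (p : V → V) (hp : IsF p) :
    ∃ ρ : V → V, (∀ v, p (ρ v) = ρ v) ∧ (∀ v, ρ (p v) = ρ v) ∧ (∀ v, p v = v → ρ v = v) ∧
      (∀ v, ∃ n, ρ v = p^[n] v) := by
  obtain ⟨h, hh⟩ := hp
  have key : ∀ n v, h v ≤ n → p (p^[n] v) = p^[n] v := by
    intro n
    induction n with
    | zero =>
      intro v hv
      by_contra hc
      have := hh v hc
      omega
    | succ n ih =>
      intro v hv
      by_cases hc : p v = v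
      · rw [Function.iterate_fixed hc, hc]
      · have := hh v hc
        rw [Function.iterate_succ_apply]
        exact ih _ (by omega)
  have key' : ∀ v, p (p^[∑ w, h w] v) = p^[∑ w, h w] v := fun v =>
    key _ v (Finset.single_le_sum (f := h) (fun _ _ => Nat.zero_le _) (Finset.mem_univ v))
  refine ⟨fun v => p^[∑ w, h w] v, key', ?_, ?_, ?_⟩
  · intro v
    change p^[∑ w, h w] (p v) = p^[∑ w, h w] v
    rw [← Function.iterate_succ_apply, Function.iterate_succ_apply', key']
  · intro v hv
    exact Function.iterate_fixed hv _
  · intro v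
    exact ⟨_, rfl⟩

theorem IsF.of_ext {p q : V → V} (hq : IsF q) (h : Ext p q) : IsF p := by
  obtain ⟨d, hd⟩ := hq
  refine ⟨d, fun v hv => ?_⟩
  have := h v hv
  rw [← this]
  apply hd
  rwa [this]

theorem root_ne_of_isF {p ρ : V → V} (hρ : ∀ v, ∃ n, ρ v = p^[n] v) {r v : V} (hr : p r = r)
    (hv : v ≠ r) (hf : IsF (Function.update p r v)) : ρ v ≠ r := by
  obtain ⟨h, hh⟩ := hf
  have step : ∀ w, h (p w) ≤ h w := by
    intro w
    by_cases hw : p w = w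
    · rw [hw]
    · have hwr : w ≠ r := fun e => hw (e ▸ hr)
      have := hh w
      rw [Function.update_of_ne hwr] at this
      exact (this hw).le
  have it : ∀ n w, h (p^[n] w) ≤ h w := by
    intro n
    induction n with
    | zero => intro w; exact le_rfl
    | succ n ih =>
      intro w
      rw [Function.iterate_succ_apply]
      exact (ih _).trans (step w)
  intro e
  obtain ⟨n, hn⟩ := hρ v
  have h1 := it n v
  rw [← hn, e] at h1
  have h2 := hh r
  rw [Function.update_self] at h2
  have := h2 hv
  omega

theorem isF_update {p ρ : V → V} (hp : IsF p) (hρ : ∀ v, ρ (p v) = ρ v)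
    (hρ' : ∀ v, p v = v → ρ v = v) {r v : V}
    (hr : p r = r) (hv : ρ v ≠ r) : IsF (Function.update p r v) := by
  obtain ⟨h, hh⟩ := hp
  refine ⟨fun w => if ρ w = r then h w + h v + 1 else h w, fun w hw => ?_⟩
  by_cases hwr : w = r
  · subst hwr
    rw [Function.update_self] at *
    simp only [if_neg hv, if_pos (hρ' w hr)]
    omega
  · rw [Function.update_of_ne hwr] at *
    have := hh w hw
    simp only [hρ]
    split_ifs <;> omega

theorem card_Q (n : ℕ) : ∀ p : V → V, IsF p → (Fx p).card = n + 1 →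
    (Q p).card = Fintype.card V ^ n := by
  induction n with
  | zero =>
    intro p hp hc
    rw [pow_zero, Finset.card_eq_one]
    refine ⟨p, ?_⟩
    ext q
    simp only [Q, mem_filter, mem_univ, true_and, mem_singleton]
    constructor
    · rintro ⟨h1, h2, h3⟩
      have hsub : Fx q ⊆ Fx p := by
        intro v hv
        simp only [Fx, mem_filter, mem_univ, true_and] at *
        by_contra hne
        exact hne ((h3 v hne).symm.trans hv)
      have heq := Finset.eq_of_subset_of_card_le hsub (by omega)
      funext v
      by_cases hv : p v = v
      · have : v ∈ Fx q := by rw [heq]; simp [Fx, hv]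
        simp only [Fx, mem_filter, mem_univ, true_and] at this
        rw [this, hv]
      · exact h3 v hv
    · rintro rfl
      exact ⟨hp, hc, fun _ _ => rfl⟩
  | succ n ih =>
    intro p hp hc
    obtain ⟨ρ, hρ1, hρ2, hρ3, hρ4⟩ := exists_root p hp
    let A : Finset (Σ _ : V → V, V) := (Q p).sigma (fun q => Fx p \ Fx q)
    let B : Finset (Σ _ : V, V) := (univ : Finset V).sigma (fun v => (Fx p).erase (ρ v))
    let C : Finset (Σ _ : (Σ _ : V, V), V → V) :=
      B.sigma (fun b => Q (Function.update p b.2 b.1))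
    have hFx : ∀ (f : V → V) v, v ∈ Fx f ↔ f v = v := by intro f v; simp [Fx]
    have hA : A.card = (Q p).card * (n + 1) := by
      rw [Finset.card_sigma, Finset.sum_const_nat]
      intro q hq
      simp only [Q, mem_filter, mem_univ, true_and] at hq
      obtain ⟨h1, h2, h3⟩ := hq
      have hsub : Fx q ⊆ Fx p := by
        intro v hv
        rw [hFx] at *
        by_contra hne
        exact hne ((h3 v hne).symm.trans hv)
      rw [Finset.card_sdiff_of_subset hsub]
      omega
    have hB : B.card = Fintype.card V * (n + 1) := by
      rw [Finset.card_sigma, Finset.sum_const_nat (m := n + 1)]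
      · rfl
      · intro v _
        rw [Finset.card_erase_of_mem (by rw [hFx]; exact hρ1 v)]
        omega
    have hC : C.card = B.card * Fintype.card V ^ n := by
      rw [Finset.card_sigma, Finset.sum_const_nat]
      rintro ⟨v, r⟩ hb
      simp only [B, mem_sigma, mem_univ, true_and, mem_erase, hFx] at hb
      obtain ⟨h1, h2⟩ := hb
      apply ih
      · exact isF_update hp hρ2 hρ3 h2 (Ne.symm h1)
      · have : Fx (Function.update p r v) = (Fx p).erase r := by
          ext w
          simp only [mem_erase, hFx]
          by_cases hw : w = r
          · subst hw
            simp only [Function.update_self, ne_eq, not_true_eq_false, false_and, iff_false]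
            rintro rfl
            exact h1 (hρ3 _ h2).symm
          · simp [Function.update_of_ne hw, hw]
        rw [this, Finset.card_erase_of_mem (by rw [hFx]; exact h2)]
        omega
    have hAC : A.card = C.card := by
      refine Finset.card_nbij' (fun a => ⟨⟨a.1 a.2, a.2⟩, a.1⟩) (fun c => ⟨c.2, c.1.2⟩) ?_ ?_ ?_ ?_
      · rintro ⟨q, r⟩ ha
        simp only [A, B, C, Q, mem_coe, mem_sigma, mem_filter, mem_univ, true_and, mem_sdiff,
          mem_erase, hFx] at ha ⊢
        obtain ⟨⟨h1, h2, h3⟩, h4, h5⟩ := ha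
        have hext : Ext (Function.update p r (q r)) q := by
          intro w hw
          by_cases hwr : w = r
          · subst hwr
            rw [Function.update_self]
          · rw [Function.update_of_ne hwr] at *
            exact h3 w hw
        exact ⟨⟨(root_ne_of_isF hρ4 h4 h5 (h1.of_ext hext)).symm, h4⟩, h1, h2, hext⟩
      · rintro ⟨⟨v, r⟩, q⟩ hcc
        simp only [A, B, C, Q, mem_coe, mem_sigma, mem_filter, mem_univ, true_and, mem_sdiff,
          mem_erase, hFx] at hcc ⊢
        obtain ⟨⟨h1, h4⟩, h5, h6, h7⟩ := hcc
        have hvr : v ≠ r := by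
          rintro rfl
          exact h1 (hρ3 _ h4).symm
        have hq : q r = v := by
          have := h7 r
          rw [Function.update_self] at this
          exact this hvr
        refine ⟨⟨h5, h6, ?_⟩, h4, by rw [hq]; exact hvr⟩
        intro w hw
        have hwr : w ≠ r := fun e => hw (e ▸ h4)
        have := h7 w
        rw [Function.update_of_ne hwr] at this
        exact this hw
      · rintro ⟨q, r⟩ ha
        rfl
      · rintro ⟨⟨v, r⟩, q⟩ hcc
        simp only [A, B, C, Q, mem_coe, mem_sigma, mem_filter, mem_univ, true_and, mem_sdiff,
          mem_erase, hFx] at hcc ⊢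
        obtain ⟨⟨h1, h4⟩, h5, h6, h7⟩ := hcc
        have hvr : v ≠ r := by
          rintro rfl
          exact h1 (hρ3 _ h4).symm
        have hq : q r = v := by
          have := h7 r
          rw [Function.update_self] at this
          exact this hvr
        rw [hq]
    rw [hA, hC, hB] at hAC
    have : (n + 1) * (Q p).card = (n + 1) * Fintype.card V ^ (n + 1) := by
      rw [mul_comm, hAC]; ring
    exact Nat.eq_of_mul_eq_mul_left (Nat.succ_pos n) this

/-- The graph of a parent function. -/
def Gr (q : V → V) : SimpleGraph V := SimpleGraph.fromRel fun a b => q a = b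

theorem Gr_adj (q : V → V) (a b : V) : (Gr q).Adj a b ↔ a ≠ b ∧ (q a = b ∨ q b = a) := by
  simp [Gr, SimpleGraph.fromRel_adj]

theorem Gr_connected {q : V → V} (hq : IsF q) {r : V} (hr : ∀ v, q v = v ↔ v = r) :
    (Gr q).Connected := by
  obtain ⟨ρ, hρ1, hρ2, hρ3, hρ4⟩ := exists_root q hq
  have step : ∀ v, (Gr q).Reachable v (q v) := by
    intro v
    by_cases hv : q v = v
    · rw [hv]
    · exact SimpleGraph.Adj.reachable ((Gr_adj q _ _).2 ⟨Ne.symm hv, Or.inl rfl⟩)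
  have it : ∀ n v, (Gr q).Reachable v (q^[n] v) := by
    intro n
    induction n with
    | zero => intro v; exact SimpleGraph.Reachable.refl _
    | succ n ih =>
      intro v
      rw [Function.iterate_succ_apply]
      exact (step v).trans (ih _)
  have hroot : ∀ v, (Gr q).Reachable v r := by
    intro v
    obtain ⟨n, hn⟩ := hρ4 v
    have h1 := it n v
    rw [← hn, (hr _).1 (hρ1 v)] at h1
    exact h1
  haveI : Nonempty V := ⟨r⟩
  exact SimpleGraph.Connected.mk fun a b => (hroot a).trans (hroot b).symm

theorem Gr_isTree {q : V → V} (hq : IsF q) {r : V} (hr : ∀ v, q v = v ↔ v = r) :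
    (Gr q).IsTree := by
  have hc := Gr_connected hq hr
  rw [SimpleGraph.isTree_iff_connected_and_card]
  refine ⟨hc, ?_⟩
  have h1 := hc.card_vert_le_card_edgeSet_add_one
  have h2 : Nat.card (Gr q).edgeSet ≤ ((univ : Finset V).erase r).card := by
    have hsub : (Gr q).edgeSet ⊆ (((univ : Finset V).erase r).image fun v => s(v, q v) : Finset _) := by
      intro e
      induction e using Sym2.ind with
      | _ a b =>
        intro he
        rw [SimpleGraph.mem_edgeSet, Gr_adj] at he
        obtain ⟨hab, h | h⟩ := he
        · simp only [mem_coe, mem_image, mem_erase, mem_univ, and_true]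
          refine ⟨a, fun e => ?_, by rw [h]⟩
          exact hab (((hr a).2 e).symm.trans h)
        · simp only [mem_coe, mem_image, mem_erase, mem_univ, and_true]
          refine ⟨b, fun e => ?_, by rw [h, Sym2.eq_swap]⟩
          exact hab (h.symm.trans ((hr b).2 e))
    have := Set.ncard_le_ncard hsub (Finset.finite_toSet _)
    rw [Set.ncard_coe_finset] at this
    exact this.trans Finset.card_image_le
  rw [Finset.card_erase_of_mem (mem_univ r), Finset.card_univ] at h2
  have : 0 < Fintype.card V := Fintype.card_pos_iff.2 ⟨r⟩
  rw [Nat.card_eq_fintype_card (α := V)] at *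
  omega

open scoped Classical in
/-- The parent function of a tree rooted at `u`. -/
noncomputable def par (T : SimpleGraph V) (u v : V) : V :=
  if h : ∃ w, T.Adj v w ∧ T.dist u w + 1 = T.dist u v then h.choose else v

theorem par_spec {T : SimpleGraph V} (hT : T.IsTree) {u v : V} (huv : v ≠ u) :
    T.Adj v (par T u v) ∧ T.dist u (par T u v) + 1 = T.dist u v := by
  have h : ∃ w, T.Adj v w ∧ T.dist u w + 1 = T.dist u v := by
    obtain ⟨p, hp⟩ := hT.1.exists_walk_length_eq_dist v u
    cases p with
    | nil => exact absurd rfl huv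
    | @cons _ w _ hadj p =>
      refine ⟨w, hadj, ?_⟩
      rw [SimpleGraph.Walk.length_cons] at hp
      have h1 := SimpleGraph.dist_le p
      have h2 := hT.1.dist_triangle (u := v) (v := w) (w := u)
      rw [SimpleGraph.dist_eq_one_iff_adj.2 hadj] at h2
      rw [SimpleGraph.dist_comm (u := u), SimpleGraph.dist_comm (u := u)]
      omega
  rw [par, dif_pos h]
  exact h.choose_spec

theorem par_self {T : SimpleGraph V} {u : V} : par T u u = u := by
  rw [par, dif_neg]
  rintro ⟨w, h1, h2⟩
  rw [SimpleGraph.dist_self] at h2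
  omega

theorem par_fix {T : SimpleGraph V} (hT : T.IsTree) {u : V} (v : V) : par T u v = v ↔ v = u := by
  constructor
  · intro h
    by_contra hne
    have := (par_spec hT hne).1
    rw [h] at this
    exact this.ne rfl
  · rintro rfl
    exact par_self

theorem par_isF {T : SimpleGraph V} (hT : T.IsTree) (u : V) : IsF (par T u) := by
  refine ⟨T.dist u, fun v hv => ?_⟩
  have : v ≠ u := fun e => hv ((par_fix hT v).2 e)
  have := (par_spec hT this).2
  omega

theorem Gr_par {T : SimpleGraph V} (hT : T.IsTree) (u : V) : Gr (par T u) = T := by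
  have hle : Gr (par T u) ≤ T := by
    intro a b hab
    rw [Gr_adj] at hab
    obtain ⟨hab, h | h⟩ := hab
    · have : a ≠ u := fun e => hab (((par_fix hT a).2 e).symm.trans h)
      rw [← h]
      exact (par_spec hT this).1
    · have : b ≠ u := fun e => hab (h.symm.trans ((par_fix hT b).2 e))
      rw [← h]
      exact (par_spec hT this).1.symm
  have hc := Gr_connected (par_isF hT u) (par_fix hT)
  exact le_antisymm hle ((SimpleGraph.isTree_iff_minimal_connected.1 hT).2 hc hle)

theorem par_Gr {q : V → V} (hq : IsF q) {r : V} (hr : ∀ v, q v = v ↔ v = r) :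
    par (Gr q) r = q := by
  have hT := Gr_isTree hq hr
  have key : ∀ n v, (Gr q).dist r v = n → par (Gr q) r v = q v := by
    intro n
    induction n using Nat.strong_induction_on with
    | _ n ih =>
      intro v hv
      by_cases hvr : v = r
      · rw [(par_fix hT v).2 hvr, (hr v).2 hvr]
      · obtain ⟨h1, h2⟩ := par_spec hT hvr
        obtain ⟨h3, h4 | h4⟩ := (Gr_adj q _ _).1 h1
        · exact h4.symm
        · exfalso
          have h5 := ih _ (by omega) _ (rfl : (Gr q).dist r (par (Gr q) r v) = _)
          rw [h4] at h5
          have hne : par (Gr q) r v ≠ r := by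
            intro e
            rw [e, (hr r).2 rfl] at h4
            exact hvr h4.symm
          have h6 := (par_spec hT hne).2
          rw [h5] at h6
          omega
  funext v
  exact key _ v rfl

theorem mem_Q_id {q : V → V} : q ∈ Q (id : V → V) ↔ IsF q ∧ ∃ r, ∀ v, q v = v ↔ v = r := by
  simp only [Q, mem_filter, mem_univ, true_and, Finset.card_eq_one]
  constructor
  · rintro ⟨h1, ⟨r, hr⟩, -⟩
    refine ⟨h1, r, fun v => ?_⟩
    have : v ∈ Fx q ↔ v ∈ ({r} : Finset V) := by rw [hr]
    simpa [Fx] using this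
  · rintro ⟨h1, r, hr⟩
    refine ⟨h1, ⟨r, ?_⟩, fun v hv => absurd rfl hv⟩
    ext v
    simp [Fx, hr]

theorem Q_sub (p : V → V) : Q p ⊆ Q (id : V → V) := by
  intro q hq
  simp only [Q, mem_filter, mem_univ, true_and] at hq ⊢
  exact ⟨hq.1, hq.2.1, fun v hv => absurd rfl hv⟩

/-- The partial forest given by a path. -/
noncomputable def pth {k : ℕ} (x : Fin (k + 1) ↪ V) : V → V :=
  Function.extend (fun i : Fin k => x i.castSucc) (fun i : Fin k => x i.succ) id

theorem pth_inj {k : ℕ} (x : Fin (k + 1) ↪ V) :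
    Function.Injective (fun i : Fin k => x i.castSucc) := fun i j h =>
  Fin.castSucc_injective _ (x.injective h)

theorem pth_apply {k : ℕ} (x : Fin (k + 1) ↪ V) (i : Fin k) : pth x (x i.castSucc) = x i.succ :=
  (pth_inj x).extend_apply _ _ i

theorem pth_ne {k : ℕ} (x : Fin (k + 1) ↪ V) (i : Fin k) : pth x (x i.castSucc) ≠ x i.castSucc := by
  rw [pth_apply]
  intro h
  have := congrArg Fin.val (x.injective h)
  simp at this

theorem pth_of_not {k : ℕ} (x : Fin (k + 1) ↪ V) (v : V) (h : ¬ ∃ i : Fin k, x i.castSucc = v) :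
    pth x v = v := Function.extend_apply' _ _ _ h

theorem pth_isF {k : ℕ} (x : Fin (k + 1) ↪ V) : IsF (pth x) := by
  refine ⟨Function.extend x (fun i => k - i.val) 0, fun v hv => ?_⟩
  by_cases h : ∃ i : Fin k, x i.castSucc = v
  · obtain ⟨i, rfl⟩ := h
    rw [pth_apply, x.injective.extend_apply, x.injective.extend_apply]
    have := i.isLt
    simp
    omega
  · exact absurd (pth_of_not x v h) hv

theorem pth_card {k : ℕ} (x : Fin (k + 1) ↪ V) : (Fx (pth x)).card = Fintype.card V - k := by
  have : Fx (pth x) = univ \ (univ.image (fun i : Fin k => x i.castSucc)) := by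
    ext v
    simp only [Fx, mem_filter, mem_univ, true_and, mem_sdiff, mem_image]
    constructor
    · rintro h ⟨i, rfl⟩
      exact pth_ne x i h
    · exact pth_of_not x v
  rw [this, Finset.card_sdiff_of_subset (Finset.subset_univ _),
    Finset.card_image_of_injective _ (pth_inj x)]
  simp

theorem follow {k : ℕ} (x : Fin (k + 1) ↪ V) {q : V → V} (hq : q ∈ Q (pth x)) (i : Fin k) :
    q (x i.castSucc) = x i.succ := by
  simp only [Q, mem_filter, mem_univ, true_and] at hq
  rw [hq.2.2 _ (pth_ne x i), pth_apply]

theorem dist_path {k : ℕ} (x : Fin (k + 1) ↪ V) {T : SimpleGraph V} (hT : T.IsTree) {u : V}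
    (hq : par T u ∈ Q (pth x)) : k ≤ T.dist u (x 0) := by
  have key : ∀ j : Fin (k + 1), T.dist u (x 0) = T.dist u (x j) + j.val := by
    intro j
    induction j using Fin.induction with
    | zero => simp
    | succ i ih =>
      have h1 := follow x hq i
      have hne : x i.castSucc ≠ u := by
        intro e
        rw [(par_fix hT _).2 e] at h1
        have := congrArg Fin.val (x.injective h1)
        simp at this
      have h2 := (par_spec hT hne).2
      rw [h1] at h2
      rw [ih]
      simp
      omega
  have := key (Fin.last k)
  simp at this
  omega

theorem path_inj {k : ℕ} (x y : Fin (k + 1) ↪ V) {q : V → V} (hx : q ∈ Q (pth x))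
    (hy : q ∈ Q (pth y)) (h0 : x 0 = y 0) : x = y := by
  ext j
  induction j using Fin.induction with
  | zero => exact h0
  | succ i ih => rw [← follow x hx, ← follow y hy, ih]

open scoped Classical in
/-- Trees on `V`. -/
noncomputable def trees (V : Type) [Fintype V] : Finset (SimpleGraph V) :=
  univ.filter fun T => T.IsTree

theorem mem_trees {T : SimpleGraph V} : T ∈ trees V ↔ T.IsTree := by simp [trees]

theorem card_trees_le [Nonempty V] :
    Fintype.card V * (trees V).card ≤ Fintype.card V ^ (Fintype.card V - 1) := by
  have hpos : 0 < Fintype.card V := Fintype.card_pos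
  rw [← card_Q (Fintype.card V - 1) (id : V → V) ⟨fun _ => 0, fun v hv => absurd rfl hv⟩
    (by simp [Fx]; omega), ← Finset.card_univ, ← Finset.card_product]
  refine Finset.card_le_card_of_injOn (fun a => par a.2 a.1) ?_ ?_
  · rintro ⟨u, T⟩ h
    simp only [mem_coe, mem_product, mem_univ, true_and, mem_trees] at h
    exact mem_Q_id.2 ⟨par_isF h u, u, par_fix h⟩
  · rintro ⟨u, T⟩ h ⟨u', T'⟩ h' e
    simp only [mem_coe, mem_product, mem_univ, true_and, mem_trees] at h h' e
    have hu : u = u' := by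
      have h1 := (par_fix h u).2 rfl
      rw [e] at h1
      exact (par_fix h' u).1 h1
    have hT : T = T' := by rw [← Gr_par h u, ← Gr_par h' u', e]
    rw [hu, hT]

theorem main_count (k : ℕ) (hk : k + 1 ≤ Fintype.card V) :
    k * ((Fintype.card V).descFactorial (k + 1) * Fintype.card V ^ (Fintype.card V - (k + 1))) ≤
      ∑ u : V, ∑ v : V, ∑ T ∈ trees V, T.dist u v := by
  let S : Finset (Σ _ : Fin (k + 1) ↪ V, V → V) :=
    (univ : Finset (Fin (k + 1) ↪ V)).sigma fun x => Q (pth x)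
  have hS : S.card =
      (Fintype.card V).descFactorial (k + 1) * Fintype.card V ^ (Fintype.card V - (k + 1)) := by
    rw [Finset.card_sigma, Finset.sum_const_nat (m := Fintype.card V ^ (Fintype.card V - (k + 1)))]
    · rw [Finset.card_univ, Fintype.card_embedding_eq, Fintype.card_fin]
    · intro x _
      exact card_Q _ _ (pth_isF x) (by rw [pth_card]; omega)
  have hex : ∀ q : V → V, ∃ a : V × SimpleGraph V, q ∈ Q (id : V → V) →
      a.2.IsTree ∧ par a.2 a.1 = q := by
    intro q
    by_cases hq : q ∈ Q (id : V → V)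
    · obtain ⟨h1, r, hr⟩ := mem_Q_id.1 hq
      exact ⟨(r, Gr q), fun _ => ⟨Gr_isTree h1 hr, par_Gr h1 hr⟩⟩
    · exact ⟨((show V from (Classical.choice (Fintype.card_pos_iff.1 (by omega)))), ⊥),
        fun h => absurd h hq⟩
  choose g hg using hex
  let D : Finset (V × V × SimpleGraph V) :=
    (univ ×ˢ univ ×ˢ trees V).filter fun a => k ≤ a.2.2.dist a.1 a.2.1
  have hSD : S.card ≤ D.card := by
    refine Finset.card_le_card_of_injOn (fun s => ((g s.2).1, s.1 0, (g s.2).2)) ?_ ?_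
    · rintro ⟨x, q⟩ h
      simp only [S, D, mem_coe, mem_sigma, mem_univ, true_and, mem_filter, mem_product,
        mem_trees] at h ⊢
      obtain ⟨h1, h2⟩ := hg q (Q_sub _ h)
      exact ⟨h1, dist_path x h1 (by rw [h2]; exact h)⟩
    · rintro ⟨x, q⟩ h ⟨y, q'⟩ h' e
      simp only [S, mem_coe, mem_sigma, mem_univ, true_and, Prod.mk.injEq] at h h' e
      obtain ⟨e1, e2, e3⟩ := e
      have hqq : q = q' := by
        rw [← (hg q (Q_sub _ h)).2, ← (hg q' (Q_sub _ h')).2, e1, e3]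
      subst hqq
      rw [path_inj x y h h' e2]
  rw [← hS]
  have hsum : ∑ u : V, ∑ v : V, ∑ T ∈ trees V, T.dist u v =
      ∑ a ∈ (univ ×ˢ univ ×ˢ trees V : Finset (V × V × SimpleGraph V)), a.2.2.dist a.1 a.2.1 := by
    rw [Finset.sum_product]
    refine Finset.sum_congr rfl fun u _ => ?_
    rw [Finset.sum_product]
  rw [hsum]
  calc k * S.card ≤ k * D.card := Nat.mul_le_mul_left _ hSD
    _ = ∑ a ∈ D, k := by rw [Finset.sum_const, smul_eq_mul, mul_comm]
    _ ≤ ∑ a ∈ D, a.2.2.dist a.1 a.2.1 := Finset.sum_le_sum fun a ha => (Finset.mem_filter.1 ha).2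
    _ ≤ _ := Finset.sum_le_sum_of_subset (Finset.filter_subset _ _)

set_option maxHeartbeats 1000000 in
theorem ratio_bound (m k : ℕ) (hm : 2 ≤ m) (hk : k + 1 ≤ m) (hk2 : 2 * (k * (k + 1)) ≤ m ∨ k = 1) :
    (k : ℝ) / 2 ≤ (∑ u : Fin m, ∑ v : Fin m, ∑ T ∈ treeFinset m, ((T.dist u v : ℝ))) /
          ((m : ℝ) ^ 2 * ((treeFinset m).card : ℝ)) := by
  haveI : Nonempty (Fin m) := ⟨⟨0, by omega⟩⟩
  have h1 := main_count (V := Fin m) k (by simpa using hk)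
  have h2 := card_trees_le (V := Fin m)
  have ht : trees (Fin m) = treeFinset m := by
    ext T
    simp [trees, treeFinset]
  rw [ht, Fintype.card_fin] at h1 h2
  have hpos : 0 < (treeFinset m).card := by
    refine Finset.card_pos.2 ?_
    obtain ⟨T, -, hT⟩ := (SimpleGraph.connected_top (V := Fin m)).exists_isTree_le
    exact ⟨T, by rw [← ht, mem_trees]; exact hT⟩
  have h1' : (k : ℝ) * ((m.descFactorial (k + 1) : ℝ) * (m : ℝ) ^ (m - (k + 1))) ≤
      ∑ u : Fin m, ∑ v : Fin m, ∑ T ∈ treeFinset m, ((T.dist u v : ℝ)) := by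
    exact_mod_cast h1
  have h2' : (m : ℝ) ^ 2 * ((treeFinset m).card : ℝ) ≤ (m : ℝ) ^ m := by
    have : m ^ 2 * (treeFinset m).card ≤ m ^ m := by
      calc m ^ 2 * (treeFinset m).card = m * (m * (treeFinset m).card) := by ring
        _ ≤ m * m ^ (m - 1) := Nat.mul_le_mul_left _ h2
        _ = m ^ m := by rw [← pow_succ']; congr 1; omega
    exact_mod_cast this
  have hmpos : (0 : ℝ) < m := by exact_mod_cast (by omega : 0 < m)
  have h3 : (m : ℝ) ^ (k + 1) ≤ 2 * (m.descFactorial (k + 1) : ℝ) := by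
    rcases hk2 with hk2 | rfl
    · have hd : (((m - k : ℕ) : ℝ)) ^ (k + 1) ≤ (m.descFactorial (k + 1) : ℝ) := by
        have := Nat.pow_sub_le_descFactorial m (k + 1)
        have e : m + 1 - (k + 1) = m - k := by omega
        rw [e] at this
        exact_mod_cast this
      have hb := one_add_mul_le_pow (a := -((k : ℝ) / m)) (by
        have : (k : ℝ) / m ≤ 1 := by
          rw [div_le_one hmpos]
          exact_mod_cast (by omega : k ≤ m)
        linarith) (k + 1)
      have hb2 : (1 : ℝ) / 2 ≤ (1 + -((k : ℝ) / m)) ^ (k + 1) := by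
        refine le_trans ?_ hb
        have : ((k + 1 : ℕ) : ℝ) * ((k : ℝ) / m) ≤ 1 / 2 := by
          rw [← mul_div_assoc, div_le_iff₀ hmpos]
          have : (2 : ℝ) * (k * (k + 1)) ≤ m := by exact_mod_cast hk2
          push_cast
          linarith
        linarith
      have e2 : ((m - k : ℕ) : ℝ) = m * (1 + -((k : ℝ) / m)) := by
        rw [Nat.cast_sub (by omega)]
        field_simp
        ring
      rw [e2, mul_pow] at hd
      have := mul_le_mul_of_nonneg_left hb2 (pow_pos hmpos (k + 1)).le
      linarith
    · have : m ^ (1 + 1) ≤ 2 * m.descFactorial (1 + 1) := by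
        obtain ⟨n, rfl⟩ := Nat.exists_eq_add_of_le hm
        simp [Nat.descFactorial]
        nlinarith
      exact_mod_cast this
  have hpos' : (0 : ℝ) < (m : ℝ) ^ 2 * ((treeFinset m).card : ℝ) := by
    have : (0 : ℝ) < ((treeFinset m).card : ℝ) := by exact_mod_cast hpos
    positivity
  rw [le_div_iff₀ hpos']
  refine le_trans ?_ h1'
  have hsplit : (m : ℝ) ^ m = (m : ℝ) ^ (k + 1) * (m : ℝ) ^ (m - (k + 1)) := by
    rw [← pow_add]; congr 1; omega
  calc (k : ℝ) / 2 * ((m : ℝ) ^ 2 * ((treeFinset m).card : ℝ)) ≤ (k : ℝ) / 2 * (m : ℝ) ^ m :=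
        mul_le_mul_of_nonneg_left h2' (by positivity)
    _ = (k : ℝ) / 2 * ((m : ℝ) ^ (k + 1) * (m : ℝ) ^ (m - (k + 1))) := by rw [hsplit]
    _ ≤ (k : ℝ) / 2 * ((2 * (m.descFactorial (k + 1) : ℝ)) * (m : ℝ) ^ (m - (k + 1))) := by
        gcongr
    _ = _ := by ring

end UST

/-- There is a constant `C > 0` such that for every `m ≥ 2`, if `T_m` is
a uniformly random spanning tree of `K_m` and `u, v` are two vertices chosen independently
and uniformly at random (independently of `T_m`), then `E[ d_{T_m}(u,v) ] ≥ C √m`.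
The expectation is written out as the average over all trees and all pairs of vertices. -/
theorem ust_expected_distance :
    ∃ C > (0 : ℝ), ∀ m : ℕ, 2 ≤ m →
      C * Real.sqrt m ≤
        (∑ u : Fin m, ∑ v : Fin m, ∑ T ∈ treeFinset m, ((T.dist u v : ℝ))) /
          ((m : ℝ) ^ 2 * ((treeFinset m).card : ℝ)) := by
  refine ⟨1 / 8, by norm_num, fun m hm => ?_⟩
  have hs := Real.sq_sqrt (Nat.cast_nonneg (α := ℝ) m)
  have hs0 := Real.sqrt_nonneg (m : ℝ)
  by_cases h4 : m < 4
  · refine le_trans ?_ (UST.ratio_bound m 1 hm (by omega) (Or.inr rfl))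
    have : (m : ℝ) < 4 := by exact_mod_cast h4
    norm_num
    nlinarith
  · have hm4 : (4 : ℝ) ≤ m := by exact_mod_cast (not_lt.1 h4)
    have hs2 : 2 ≤ Real.sqrt m := by nlinarith
    have hk1 : (⌊Real.sqrt m / 2⌋₊ : ℝ) ≤ Real.sqrt m / 2 := Nat.floor_le (by positivity)
    have hk2 := Nat.lt_floor_add_one (Real.sqrt m / 2)
    have hk3 : 1 ≤ ⌊Real.sqrt m / 2⌋₊ := Nat.le_floor (by push_cast; linarith)
    generalize ⌊Real.sqrt m / 2⌋₊ = k at *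
    have hk3' : (1 : ℝ) ≤ k := by exact_mod_cast hk3
    have hb : 2 * (k * (k + 1)) ≤ m := by
      have : (2 : ℝ) * (k * (k + 1)) ≤ m := by nlinarith
      exact_mod_cast this
    refine le_trans ?_ (UST.ratio_bound m k hm (by nlinarith) (Or.inl hb))
    linarith
end
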